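/- arXiv:1605.07902 — 5 statements merged into one kernel-verified Lean document; each statement's English description precedes it below -/
import Mathlib

section
/- For every real k, the three leading principal minors of B₁(k) are given by: (B₁(k))₁₁ = (2μe+λe)k²/ρ; the 2×2 leading principal minor equals (k²/(3ηρ))·[6(2μe+λe)μmicro + 6μe·κe + (2μe+λe)μe·L_c²·k²]; and det B₁(k) = (k²/(η²ρ))·[6κe·κmicro(μe+μmicro) + 8μe·μmicro(κe+κmicro) + (2μe+λe)(2μmicro+λmicro)·μe·L_c²·k²]. -/
open Real

/-- The longitudinal acoustic block `B₁(k)` of the relaxed micromorphic model. -/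
noncomputable def B1 (μe lamE μmicro lamMicro ρ η Lc k : ℝ) : Matrix (Fin 3) (Fin 3) ℝ :=
  let cp2 := (2 * μe + lamE) / ρ
  let cm2 := μe * Lc ^ 2 / η
  let ωs2 := 2 * (μe + μmicro) / η
  let ωp2 := ((2 * μe + 3 * lamE) + (2 * μmicro + 3 * lamMicro)) / η
  !![cp2 * k ^ 2,
     (2 * Real.sqrt 6 / 3) * k * μe / Real.sqrt (ρ * η),
     (Real.sqrt 3 / 3) * k * (2 * μe + 3 * lamE) / Real.sqrt (ρ * η);
     (2 * Real.sqrt 6 / 3) * k * μe / Real.sqrt (ρ * η),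
     (1 / 3) * k ^ 2 * cm2 + ωs2,
     -(Real.sqrt 2 / 3) * k ^ 2 * cm2;
     (Real.sqrt 3 / 3) * k * (2 * μe + 3 * lamE) / Real.sqrt (ρ * η),
     -(Real.sqrt 2 / 3) * k ^ 2 * cm2,
     (2 / 3) * k ^ 2 * cm2 + ωp2]

/-- The three leading principal minors of `B₁(k)`: explicit formulas in terms of the
material parameters, with `κe = (2μe+3λe)/3` and `κmicro = (2μmicro+3λmicro)/3`. -/
theorem B1_leading_principal_minors (μe lamE μmicro lamMicro κe κmicro ρ η Lc k : ℝ)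
    (hκe : κe = (2 * μe + 3 * lamE) / 3)
    (hκmicro : κmicro = (2 * μmicro + 3 * lamMicro) / 3)
    (hρ : ρ > 0) (hη : η > 0) (hLc : Lc > 0) :
    (B1 μe lamE μmicro lamMicro ρ η Lc k) 0 0 = (2 * μe + lamE) * k ^ 2 / ρ ∧
    (B1 μe lamE μmicro lamMicro ρ η Lc k) 0 0 * (B1 μe lamE μmicro lamMicro ρ η Lc k) 1 1 -
      (B1 μe lamE μmicro lamMicro ρ η Lc k) 0 1 * (B1 μe lamE μmicro lamMicro ρ η Lc k) 1 0 =
      (k ^ 2 / (3 * η * ρ)) *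
        (6 * (2 * μe + lamE) * μmicro + 6 * μe * κe +
          (2 * μe + lamE) * μe * Lc ^ 2 * k ^ 2) ∧
    (B1 μe lamE μmicro lamMicro ρ η Lc k).det =
      (k ^ 2 / (η ^ 2 * ρ)) *
        (6 * κe * κmicro * (μe + μmicro) + 8 * μe * μmicro * (κe + κmicro) +
          (2 * μe + lamE) * (2 * μmicro + lamMicro) * μe * Lc ^ 2 * k ^ 2) := by
  have h2 : √2 ^ 2 = (2 : ℝ) := sq_sqrt (by norm_num)
  have h3 : √3 ^ 2 = (3 : ℝ) := sq_sqrt (by norm_num)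
  have h6 : √6 = √2 * √3 := by rw [← sqrt_mul (by norm_num)]; norm_num
  obtain ⟨a, ha, rfl⟩ : ∃ a : ℝ, 0 < a ∧ a ^ 2 = ρ := ⟨√ρ, sqrt_pos.2 hρ, sq_sqrt hρ.le⟩
  obtain ⟨b, hb, rfl⟩ : ∃ b : ℝ, 0 < b ∧ b ^ 2 = η := ⟨√η, sqrt_pos.2 hη, sq_sqrt hη.le⟩
  have hab : √(a ^ 2 * b ^ 2) = a * b := by rw [← mul_pow, sqrt_sq (by positivity)]
  subst hκe hκmicro
  refine ⟨?_, ?_, ?_⟩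
  · simp [B1, div_mul_eq_mul_div]
  · simp only [B1, hab, h6, Matrix.of_apply, Matrix.cons_val]
    generalize √2 = s at h2 ⊢
    generalize √3 = t at h3 ⊢
    field_simp
    grind
  · simp only [Matrix.det_fin_three, B1, hab, h6, Matrix.of_apply, Matrix.cons_val]
    generalize √2 = s at h2 ⊢
    generalize √3 = t at h3 ⊢
    field_simp
    grind
end

section
/- Assume ρ > 0, η > 0, L_c > 0. Then the matrix B₂(k) is positive definite for every real k ≠ 0 if and only if μe > 0, μmicro > 0 and μc ≥ 0. -/
open Real

/-- The transverse acoustic block `B₂(k)` of the relaxed micromorphic model. -/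
noncomputable def B2 (μe μmicro μc ρ η Lc k : ℝ) : Matrix (Fin 3) (Fin 3) ℝ :=
  let cs2 := (μe + μc) / ρ
  let cm2 := μe * Lc ^ 2 / η
  let ωs2 := 2 * (μe + μmicro) / η
  let ωr2 := 2 * μc / η
  !![k ^ 2 * cs2,
     Real.sqrt 2 * k * μe / Real.sqrt (ρ * η),
     -(Real.sqrt 2 * k * μc / Real.sqrt (ρ * η));
     Real.sqrt 2 * k * μe / Real.sqrt (ρ * η),
     (1 / 2) * k ^ 2 * cm2 + ωs2,
     (1 / 2) * k ^ 2 * cm2;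
     -(Real.sqrt 2 * k * μc / Real.sqrt (ρ * η)),
     (1 / 2) * k ^ 2 * cm2,
     (1 / 2) * k ^ 2 * cm2 + ωr2]

open Matrix in
/-- The quadratic form of `B₂(k)` as a combination of squares, in rescaled coordinates. -/
lemma B2_quadraticForm (μe μmicro μc ρ η Lc k : ℝ) (hρ : 0 < ρ) (hη : 0 < η) (u v w : ℝ) :
    ![√ρ * u, √η * v, √η * w] ⬝ᵥ
        (B2 μe μmicro μc ρ η Lc k *ᵥ ![√ρ * u, √η * v, √η * w]) =
      μe * ((k * u + √2 * v) ^ 2 + k ^ 2 * Lc ^ 2 / 2 * (v + w) ^ 2) +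
        μc * (k * u - √2 * w) ^ 2 + 2 * μmicro * v ^ 2 := by
  have hr : √ρ ≠ 0 := (Real.sqrt_pos.2 hρ).ne'
  have hn : √η ≠ 0 := (Real.sqrt_pos.2 hη).ne'
  have h2 : √2 ^ 2 = (2 : ℝ) := Real.sq_sqrt (by norm_num)
  have hρ2 : ρ = √ρ ^ 2 := (Real.sq_sqrt hρ.le).symm
  have hη2 : η = √η ^ 2 := (Real.sq_sqrt hη.le).symm
  simp only [B2, Real.sqrt_mul hρ.le, dotProduct, mulVec, Fin.sum_univ_three, of_apply, cons_val]
  generalize √ρ = r at *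
  generalize √η = n at *
  subst hρ2 hη2
  field_simp
  linear_combination (-2 * μe * v ^ 2 - 2 * μc * w ^ 2) * h2

/-- `B₂(k)` is symmetric. -/
lemma B2_isHermitian (μe μmicro μc ρ η Lc k : ℝ) :
    (B2 μe μmicro μc ρ η Lc k).IsHermitian := by
  ext i j
  fin_cases i <;> fin_cases j <;> simp [B2]

/-- Positive definiteness of `B₂(k)` in rescaled coordinates. -/
lemma B2_posDef_iff_forall (μe μmicro μc ρ η Lc k : ℝ) (hρ : 0 < ρ) (hη : 0 < η) :
    (B2 μe μmicro μc ρ η Lc k).PosDef ↔ ∀ u v w : ℝ, (u ≠ 0 ∨ v ≠ 0 ∨ w ≠ 0) →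
      0 < μe * ((k * u + √2 * v) ^ 2 + k ^ 2 * Lc ^ 2 / 2 * (v + w) ^ 2) +
        μc * (k * u - √2 * w) ^ 2 + 2 * μmicro * v ^ 2 := by
  have hr : √ρ ≠ 0 := (Real.sqrt_pos.2 hρ).ne'
  have hn : √η ≠ 0 := (Real.sqrt_pos.2 hη).ne'
  rw [Matrix.posDef_iff_dotProduct_mulVec]
  constructor
  · rintro ⟨-, h⟩ u v w huvw
    rw [← B2_quadraticForm μe μmicro μc ρ η Lc k hρ hη]
    have hx : ![√ρ * u, √η * v, √η * w] ≠ 0 := by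
      intro h0
      have h1 := congrFun h0 0
      have h2 := congrFun h0 1
      have h3 := congrFun h0 2
      simp_all
    simpa only [star_trivial] using h hx
  · refine fun h => ⟨B2_isHermitian .., fun {x} hx => ?_⟩
    have hxe : x = ![√ρ * (x 0 / √ρ), √η * (x 1 / √η), √η * (x 2 / √η)] := by
      ext i
      fin_cases i <;> simp <;> field_simp
    rw [star_trivial, hxe, B2_quadraticForm μe μmicro μc ρ η Lc k hρ hη]
    apply h
    by_contra! h0
    apply hx
    rw [hxe]
    simp [h0]

/-- Necessary and sufficient condition for the transverse acoustic block `B₂(k)` of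
the relaxed micromorphic model to be positive definite for every real `k ≠ 0`:
`μe > 0`, `μmicro > 0` and `μc ≥ 0`. -/
theorem B2_posDef_iff (μe μmicro μc ρ η Lc : ℝ)
    (hρ : ρ > 0) (hη : η > 0) (hLc : Lc > 0) :
    (∀ k : ℝ, k ≠ 0 → (B2 μe μmicro μc ρ η Lc k).PosDef) ↔
      μe > 0 ∧ μmicro > 0 ∧ μc ≥ 0 := by
  simp only [B2_posDef_iff_forall _ _ _ _ _ _ _ hρ hη]
  have h2 : √2 ^ 2 = (2 : ℝ) := Real.sq_sqrt (by norm_num)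
  constructor
  · intro h
    have hs : √2 ≠ 0 := by positivity
    have he : μe > 0 := by
      have h1 := h (√2) hs 1 0 1 (by simp)
      have h3 : 0 < μe * (2 + Lc ^ 2) := by linear_combination h1 + μe * (1 + Lc ^ 2 / 2) * h2
      exact pos_of_mul_pos_left h3 (by positivity)
    refine ⟨he, ?_, ?_⟩
    · have h1 := h (√2) hs (-1) 1 (-1) (by simp)
      linarith [show μe * ((√2 * -1 + √2 * 1) ^ 2 + √2 ^ 2 * Lc ^ 2 / 2 * (1 + -1) ^ 2) +
        μc * (√2 * -1 - √2 * -1) ^ 2 + 2 * μmicro * 1 ^ 2 = 2 * μmicro by ring]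
    · by_contra! hc
      have ht : 0 < -μc / μe := div_pos (neg_pos.2 hc) he
      have h1 := h (2 * √(-μc / μe) / Lc) (by positivity) 0 0 1 (by simp)
      have h3 : (2 * √(-μc / μe) / Lc) ^ 2 * Lc ^ 2 / 2 = 2 * (-μc / μe) := by
        rw [div_pow, mul_pow, Real.sq_sqrt ht.le]
        field_simp
      have h4 : μe * (-μc / μe) = -μc := by field_simp
      rw [h3] at h1
      linarith [show μe * ((2 * √(-μc / μe) / Lc * 0 + √2 * 0) ^ 2 +
        2 * (-μc / μe) * (0 + 1) ^ 2) + μc * (2 * √(-μc / μe) / Lc * 0 - √2 * 1) ^ 2 +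
        2 * μmicro * 0 ^ 2 = 0 by linear_combination 2 * h4 + μc * h2]
  · rintro ⟨he, hm, hc⟩ k hk u v w huvw
    have hkL : 0 < k ^ 2 * Lc ^ 2 / 2 := by positivity
    rcases eq_or_ne v 0 with rfl | hv
    · rcases eq_or_ne u 0 with rfl | hu
      · have hw : w ≠ 0 := by simpa using huvw
        simp only [mul_zero, zero_add]
        positivity
      · simp only [mul_zero, zero_add, add_zero]
        positivity
    · positivity
end

section
/- Assume ρ > 0, η > 0, L_c > 0, and suppose that for every real k ≠ 0 the matrices B₁(k), B₂(k), B₄(k) are positive definite and that B₁(0), B₂(0), B₄(0) are positive semidefinite. Then necessarily μe > 0, μmicro > 0, μc ≥ 0, 2μe+λe > 0, 2μmicro+λmicro > 0 and κe + κmicro ≥ 0. -/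
open Real

/-- The uncoupled block `B₄(k)` of the acoustic tensor of the relaxed micromorphic model. -/
noncomputable def B4 (μe μmicro μc η Lc k : ℝ) : Matrix (Fin 3) (Fin 3) ℝ :=
  let cm2 := μe * Lc ^ 2 / η
  let ωs2 := 2 * (μe + μmicro) / η
  let ωr2 := 2 * μc / η
  Matrix.diagonal ![cm2 * k ^ 2 + ωs2, cm2 * k ^ 2 + ωr2, cm2 * k ^ 2 + ωs2]

/-- The quadratic form of a positive definite real `3 × 3` matrix is positive away from `0`. -/
theorem Matrix.PosDef.quadForm_fin_three_pos {M : Matrix (Fin 3) (Fin 3) ℝ} (hM : M.PosDef)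
    (a b c : ℝ) (h : ![a, b, c] ≠ 0) :
    0 < a * (M 0 0 * a + M 0 1 * b + M 0 2 * c) + b * (M 1 0 * a + M 1 1 * b + M 1 2 * c) +
      c * (M 2 0 * a + M 2 1 * b + M 2 2 * c) := by
  have := hM.dotProduct_mulVec_pos h
  simpa [dotProduct, Matrix.mulVec, Fin.sum_univ_three] using this

/-- Necessity: if the blocks `B₁(k)`, `B₂(k)`, `B₄(k)` of the acoustic tensor of the
relaxed micromorphic model are positive definite for every `k ≠ 0` and positive
semidefinite at `k = 0`, then necessarily `μe > 0`, `μmicro > 0`, `μc ≥ 0`,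
`2μe+λe > 0`, `2μmicro+λmicro > 0` and `κe + κmicro ≥ 0`. -/
theorem necessity_of_conditions
    (μe lamE μmicro lamMicro μc κe κmicro ρ η Lc : ℝ)
    (hκe : κe = (2 * μe + 3 * lamE) / 3)
    (hκmicro : κmicro = (2 * μmicro + 3 * lamMicro) / 3)
    (hρ : ρ > 0) (hη : η > 0) (hLc : Lc > 0)
    (hpd : ∀ k : ℝ, k ≠ 0 →
      (B1 μe lamE μmicro lamMicro ρ η Lc k).PosDef ∧
      (B2 μe μmicro μc ρ η Lc k).PosDef ∧
      (B4 μe μmicro μc η Lc k).PosDef)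
    (hpsd : (B1 μe lamE μmicro lamMicro ρ η Lc 0).PosSemidef ∧
      (B2 μe μmicro μc ρ η Lc 0).PosSemidef ∧
      (B4 μe μmicro μc η Lc 0).PosSemidef) :
    μe > 0 ∧ μmicro > 0 ∧ μc ≥ 0 ∧
    2 * μe + lamE > 0 ∧ 2 * μmicro + lamMicro > 0 ∧ κe + κmicro ≥ 0 := by
  obtain ⟨hB1, hB2, -⟩ := hpd 1 one_ne_zero
  obtain ⟨r, hr, hr0⟩ : ∃ r, r = √(ρ * η) ∧ 0 < r := ⟨_, rfl, by positivity⟩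
  have hr2 : r ^ 2 = ρ * η := by rw [hr]; exact Real.sq_sqrt (by positivity)
  have h2 : √2 ^ 2 = (2 : ℝ) := Real.sq_sqrt (by norm_num)
  have h3 : √3 ^ 2 = (3 : ℝ) := Real.sq_sqrt (by norm_num)
  have h6 : √6 = √2 * √3 := by rw [← Real.sqrt_mul (by norm_num)]; norm_num
  have hμc : 0 ≤ μc := by
    have h := hpsd.2.1.diag_nonneg (i := 2)
    simp [B2] at h
    rw [le_div_iff₀ hη] at h
    linarith
  have hκ : 0 ≤ (2 * μe + 3 * lamE) + (2 * μmicro + 3 * lamMicro) := by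
    have h := hpsd.1.diag_nonneg (i := 2)
    simp [B1] at h
    rwa [le_div_iff₀ hη, zero_mul] at h
  have hp : 0 < 2 * μe + lamE := by
    have h := hB1.diag_pos (i := 0)
    simp [B1] at h
    rwa [lt_div_iff₀ hρ, zero_mul] at h
  have hs : 0 < μe + μc := by
    have h := hB2.diag_pos (i := 0)
    simp [B2] at h
    rwa [lt_div_iff₀ hρ, zero_mul] at h
  have hμe_nonneg : 0 ≤ μe := by
    by_contra! hneg
    have hq : 0 < 2 * μc / -μe := div_pos (by linarith) (by linarith)
    have hk : √(2 * μc / -μe) / Lc ≠ 0 := by positivity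
    have h := (hpd _ hk).2.2.diag_pos (i := 1)
    simp only [B4, Matrix.diagonal_apply_eq, Matrix.cons_val_one, Matrix.cons_val_zero, div_pow,
      Real.sq_sqrt hq.le] at h
    have hne := hneg.ne
    have : μe * Lc ^ 2 / η * (2 * μc / -μe / Lc ^ 2) + 2 * μc / η = 0 := by
      field_simp
      ring
    linarith
  have hμe_ne : μe ≠ 0 := by
    rintro rfl
    have h := hB2.quadForm_fin_three_pos (√2 * r / η) 0 1
      (fun h => by simpa using congrFun h 2)
    simp [B2, ← hr] at h
    refine h.ne' ?_
    field_simp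
    rw [h2, hr2]
    ring
  have hμmicro : 0 < μmicro := by
    have h := hB2.quadForm_fin_three_pos (-(√2 * r / η)) 1 (-1)
      (fun h => by simpa using congrFun h 1)
    simp [B2, ← hr] at h
    field_simp at h
    ring_nf at h
    simp only [h2, hr2] at h
    refine pos_of_mul_pos_right (a := 4 * (ρ * η)) ?_ (by positivity)
    linarith
  have hmicro : 0 < 2 * μmicro + lamMicro := by
    have h := hB1.quadForm_fin_three_pos (-(√3 * r / η)) √2 1
      (fun h => by simpa using congrFun h 2)
    simp [B1, ← hr, h6] at h
    field_simp at h
    ring_nf at h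
    simp only [h2, h3, hr2] at h
    refine pos_of_mul_pos_right (a := 9 * (ρ * η)) ?_ (by positivity)
    linarith
  refine ⟨lt_of_le_of_ne hμe_nonneg hμe_ne.symm, hμmicro, hμc, hp, hmicro, ?_⟩
  rw [hκe, hκmicro]
  linarith
end

section
/- Assume ρ > 0, η > 0, L_c > 0. Then the matrix B₇(k) is positive definite for every real k ≠ 0 if and only if μ > 0 and μc ≥ 0. -/
open Real

/-- The transverse block `B₇(k)` of the acoustic tensor of the isotropic Cosserat
(micropolar) model with uni-constant curvature. -/
noncomputable def B7 (μ μc ρ η Lc k : ℝ) : Matrix (Fin 2) (Fin 2) ℝ :=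
  !![k ^ 2 * (μ + μc) / ρ, Real.sqrt 2 * k * μc / Real.sqrt (ρ * η);
     Real.sqrt 2 * k * μc / Real.sqrt (ρ * η), (k ^ 2 * μ * Lc ^ 2 + 4 * μc) / (2 * η)]

/-- Sylvester's criterion for real symmetric `2 × 2` matrices. -/
theorem posDef_fin_two_iff (a b c : ℝ) :
    (!![a, b; b, c] : Matrix (Fin 2) (Fin 2) ℝ).PosDef ↔ 0 < a ∧ 0 < a * c - b * b := by
  constructor
  · intro h
    exact ⟨by simpa using h.diag_pos (i := 0), by simpa [Matrix.det_fin_two] using h.det_pos⟩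
  · rintro ⟨ha, hd⟩
    refine Matrix.PosDef.of_dotProduct_mulVec_pos ?_ fun x hx => ?_
    · ext i j
      fin_cases i <;> fin_cases j <;> simp
    · have hsum : 0 < (a * x 0 + b * x 1) ^ 2 + (a * c - b * b) * x 1 ^ 2 := by
        by_cases h1 : x 1 = 0
        · have h0 : x 0 ≠ 0 := fun h0 => hx (by ext i; fin_cases i <;> simp [h0, h1])
          simp only [h1, mul_zero, add_zero]
          positivity
        · positivity
      refine pos_of_mul_pos_right (a := a) ?_ ha.le
      simp [dotProduct, Matrix.mulVec, Fin.sum_univ_two]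
      linarith

theorem B7_det (μ μc ρ η Lc k : ℝ) (hρ : 0 < ρ) (hη : 0 < η) :
    k ^ 2 * (μ + μc) / ρ * ((k ^ 2 * μ * Lc ^ 2 + 4 * μc) / (2 * η)) -
        Real.sqrt 2 * k * μc / Real.sqrt (ρ * η) * (Real.sqrt 2 * k * μc / Real.sqrt (ρ * η)) =
      k ^ 2 / (2 * ρ * η) * (μ * ((μ + μc) * (k * Lc) ^ 2 + 4 * μc)) := by
  rw [div_mul_div_comm (Real.sqrt 2 * k * μc), Real.mul_self_sqrt (by positivity),
    show Real.sqrt 2 * k * μc * (Real.sqrt 2 * k * μc) = 2 * (k * μc) ^ 2 by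
      linear_combination (k * μc) ^ 2 * Real.mul_self_sqrt (zero_le_two (α := ℝ))]
  field_simp
  ring

theorem B7_posDef_iff_of_ne_zero (μ μc ρ η Lc k : ℝ) (hρ : 0 < ρ) (hη : 0 < η) (hk : k ≠ 0) :
    (B7 μ μc ρ η Lc k).PosDef ↔
      0 < μ + μc ∧ 0 < μ * ((μ + μc) * (k * Lc) ^ 2 + 4 * μc) := by
  rw [B7, posDef_fin_two_iff, B7_det μ μc ρ η Lc k hρ hη, mul_pos_iff_of_pos_left (by positivity),
    div_pos_iff_of_pos_right hρ, mul_pos_iff_of_pos_left (by positivity)]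

/-- Necessary and sufficient condition for the transverse Cosserat block `B₇(k)` to
be positive definite for every real `k ≠ 0`: `μ > 0` and `μc ≥ 0`. -/
theorem B7_posDef_iff (μ μc ρ η Lc : ℝ) (hρ : ρ > 0) (hη : η > 0) (hLc : Lc > 0) :
    (∀ k : ℝ, k ≠ 0 → (B7 μ μc ρ η Lc k).PosDef) ↔ μ > 0 ∧ μc ≥ 0 := by
  constructor
  · intro h
    have key (s : ℝ) (hs : s ≠ 0) : 0 < μ + μc ∧ 0 < μ * ((μ + μc) * s ^ 2 + 4 * μc) := by
      have hk : s / Lc ≠ 0 := div_ne_zero hs hLc.ne'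
      have := (B7_posDef_iff_of_ne_zero μ μc ρ η Lc _ hρ hη hk).1 (h _ hk)
      rwa [div_mul_cancel₀ _ hLc.ne'] at this
    obtain ⟨hsum, hdet⟩ := key 1 one_ne_zero
    have hμ : 0 < μ := by
      by_contra! hμ
      exact hdet.not_ge (mul_nonpos_of_nonpos_of_nonneg hμ (by linarith))
    refine ⟨hμ, ?_⟩
    by_contra! hμc
    have hq : 0 < -(4 * μc) / (μ + μc) := div_pos (by linarith) hsum
    have hzero := (key _ (Real.sqrt_pos.2 hq).ne').2
    rw [Real.sq_sqrt hq.le, mul_div_cancel₀ _ hsum.ne'] at hzero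
    simp at hzero
  · rintro ⟨hμ, hμc⟩ k hk
    exact (B7_posDef_iff_of_ne_zero μ μc ρ η Lc k hρ hη hk).2 ⟨by positivity, by positivity⟩
end

section
/- Strong ellipticity does not imply real planar wave velocities in the Cosserat model: for every μ > 0, every λ with 2μ + λ > 0, every μc with −μ < μc < 0 (so that the strong ellipticity conditions 2μ+λ > 0 and μ+μc > 0 hold), and every ρ > 0, η > 0, L_c > 0, there exists a real k ≠ 0 such that det B₇(k) < 0; in particular B₇(k) is not positive semidefinite, so the corresponding eigenvalue ω² is negative and the wave velocity is not real. -/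
open Real

theorem det_B7 (μ μc Lc k : ℝ) {ρ η : ℝ} (hρ : 0 < ρ) (hη : 0 < η) :
    (B7 μ μc ρ η Lc k).det =
      k ^ 2 / (2 * η * ρ) * (4 * μ * μc + k ^ 2 * μ * Lc ^ 2 * (μ + μc)) := by
  have hoff : (√2 * k * μc / √(ρ * η)) * (√2 * k * μc / √(ρ * η)) =
      2 * k ^ 2 * μc ^ 2 / (ρ * η) := by
    rw [← sq, div_pow, mul_pow, mul_pow, Real.sq_sqrt zero_le_two,
      Real.sq_sqrt (mul_pos hρ hη).le]
  rw [B7, Matrix.det_fin_two_of, hoff]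
  field_simp
  ring

/-- Strong ellipticity does not imply real planar wave velocities in the Cosserat
model: for `μ > 0`, `2μ + λ > 0` and `−μ < μc < 0` (so that strong ellipticity
`2μ+λ > 0`, `μ+μc > 0` holds), there is a real `k ≠ 0` with `det B₇(k) < 0`;
in particular `B₇(k)` is not positive semidefinite. -/
theorem strong_ellipticity_not_sufficient (μ lam μc ρ η Lc : ℝ)
    (hμ : μ > 0) (hlam : 2 * μ + lam > 0)
    (hμc1 : -μ < μc) (hμc2 : μc < 0)
    (hρ : ρ > 0) (hη : η > 0) (hLc : Lc > 0) :
    ∃ k : ℝ, k ≠ 0 ∧ (B7 μ μc ρ η Lc k).det < 0 ∧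
      ¬ (B7 μ μc ρ η Lc k).PosSemidef := by
  have hsum : 0 < μ + μc := by linarith
  have hden : 0 < Lc ^ 2 * (μ + μc) := by positivity
  have hpos : 0 < -2 * μc / (Lc ^ 2 * (μ + μc)) := div_pos (by linarith) hden
  set k := √(-2 * μc / (Lc ^ 2 * (μ + μc)))
  have hk : 0 < k := Real.sqrt_pos.mpr hpos
  have hksq : k ^ 2 * (Lc ^ 2 * (μ + μc)) = -2 * μc := by
    rw [Real.sq_sqrt hpos.le, div_mul_cancel₀ _ hden.ne']
  have hdet : (B7 μ μc ρ η Lc k).det < 0 := by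
    rw [det_B7 μ μc Lc k hρ hη]
    refine mul_neg_of_pos_of_neg (by positivity) ?_
    calc 4 * μ * μc + k ^ 2 * μ * Lc ^ 2 * (μ + μc) = 2 * μ * μc := by
          linear_combination μ * hksq
      _ < 0 := mul_neg_of_pos_of_neg (by positivity) hμc2
  exact ⟨k, hk.ne', hdet, fun h => hdet.not_ge h.det_nonneg⟩
end
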